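/- arXiv:2503.19882 — 3 statements merged into one kernel-verified Lean document; each statement's English description precedes it below -/
import Mathlib

section
/- Fix k ≥ 1, p ∈ ℂ, e ∈ ℂ×, and b = (b₁,…,b_{k−1}), g = (g₁,…,g_{k−1}) ∈ ℂ^{k−1}. Then for every 1 ≤ m ≤ k the determinant of the lower-right m×m submatrix of y(p,e,b,g) equals t − p − ∑_{i=m}^{k−1} b_i g_i (an element of ℂ[t]; the empty sum for m = k being 0), and det y(p,e,b,g) = 1. -/
open Matrix

noncomputable section

/-- `K = ℂ((t⁻¹))`, the field of formal Laurent series in `t⁻¹`.  We realize it as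
`LaurentSeries ℂ`, where the Laurent-series variable `X` plays the role of `t⁻¹`;
thus for `f : K`, `f.coeff j` is the coefficient of `t^{-j}`. -/
abbrev K : Type := LaurentSeries ℂ

/-- The element `t` (the inverse of the Laurent series variable). -/
def tK : K := (HahnSeries.single (-1 : ℤ) (1 : ℂ))

/-- The constant embedding `ℂ → K`. -/
def Cc (z : ℂ) : K := HahnSeries.C z

/-- `f ∈ 𝒪 = ℂ[[t⁻¹]]` : no positive powers of `t`. -/
def memO (f : K) : Prop := ∀ j : ℤ, j < 0 → f.coeff j = 0

/-- `f ∈ 𝒪₁ = t⁻¹ℂ[[t⁻¹]]`. -/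
def memO1 (f : K) : Prop := ∀ j : ℤ, j ≤ 0 → f.coeff j = 0

/-- `f ∈ ℂ[t]`. -/
def memPoly (f : K) : Prop := ∀ j : ℤ, 0 < j → f.coeff j = 0

/-- Upper unitriangular matrix. -/
def IsUpperUni {R : Type*} [Zero R] [One R] {m : ℕ} (M : Matrix (Fin m) (Fin m) R) : Prop :=
  (∀ i, M i i = 1) ∧ ∀ i j : Fin m, j < i → M i j = 0

/-- Lower unitriangular matrix. -/
def IsLowerUni {R : Type*} [Zero R] [One R] {m : ℕ} (M : Matrix (Fin m) (Fin m) R) : Prop :=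
  (∀ i, M i i = 1) ∧ ∀ i j : Fin m, i < j → M i j = 0

/-- `M ∈ N₁[[t⁻¹]]` : upper unitriangular with off-diagonal entries in `𝒪₁`. -/
def MemN1 {m : ℕ} (M : Matrix (Fin m) (Fin m) K) : Prop :=
  IsUpperUni M ∧ ∀ i j : Fin m, i ≠ j → memO1 (M i j)

/-- `M ∈ N₋,₁[[t⁻¹]]`. -/
def MemN1neg {m : ℕ} (M : Matrix (Fin m) (Fin m) K) : Prop :=
  IsLowerUni M ∧ ∀ i j : Fin m, i ≠ j → memO1 (M i j)

/-- `M ∈ T₁[[t⁻¹]]` : diagonal with entries in `1 + 𝒪₁`. -/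
def MemT1 {m : ℕ} (M : Matrix (Fin m) (Fin m) K) : Prop :=
  (∀ i j : Fin m, i ≠ j → M i j = 0) ∧ ∀ i, memO1 (M i i - 1)

/-- `M ∈ N[t]` : upper unitriangular with entries in `ℂ[t]`. -/
def MemNpoly {m : ℕ} (M : Matrix (Fin m) (Fin m) K) : Prop :=
  IsUpperUni M ∧ ∀ i j : Fin m, memPoly (M i j)

/-- `M ∈ N₋[t]` : lower unitriangular with entries in `ℂ[t]`. -/
def MemNnegPoly {m : ℕ} (M : Matrix (Fin m) (Fin m) K) : Prop :=
  IsLowerUni M ∧ ∀ i j : Fin m, memPoly (M i j)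

/-- `t^ν = diag(t^{ν₁},…,t^{ν_m})`. -/
def tPow {m : ℕ} (ν : Fin m → ℤ) : Matrix (Fin m) (Fin m) K :=
  Matrix.diagonal fun i => tK ^ ν i

/-- `y = u · h · t^ν · l` is a Gauss factorization exhibiting membership in `Gr_ν`. -/
def IsGauss {m : ℕ} (ν : Fin m → ℤ) (y u h l : Matrix (Fin m) (Fin m) K) : Prop :=
  MemN1 u ∧ MemT1 h ∧ MemN1neg l ∧ y = u * h * tPow ν * l

/-- The matrix slice `Gr_ν = N₁[[t⁻¹]]·T₁[[t⁻¹]]·t^ν·N₋,₁[[t⁻¹]]`. -/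
def GrSlice {m : ℕ} (ν : Fin m → ℤ) : Set (Matrix (Fin m) (Fin m) K) :=
  { y | ∃ u h l, IsGauss ν y u h l }

/-- Block embedding `τ_α : Mat_{k+1} → Mat_n` into (1-indexed) rows and columns `r₁,…,r₁+k`,
identity outside this block. -/
def blockEmbed {R : Type*} [Zero R] [One R] (n r₁ k : ℕ)
    (g : Matrix (Fin (k+1)) (Fin (k+1)) R) : Matrix (Fin n) (Fin n) R :=
  fun i j =>
    if h : r₁ - 1 ≤ (i : ℕ) ∧ (i : ℕ) ≤ r₁ - 1 + k ∧ r₁ - 1 ≤ (j : ℕ) ∧ (j : ℕ) ≤ r₁ - 1 + k then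
      g ⟨(i : ℕ) - (r₁ - 1), by omega⟩ ⟨(j : ℕ) - (r₁ - 1), by omega⟩
    else if i = j then 1 else 0

/-- The coweight `α` of `PGL_n` : `α_{r₁} = 1`, `α_{r₂+1} = -1` (1-indexed), all other
entries `0`. -/
def alphaCo (n r₁ r₂ : ℕ) : Fin n → ℤ :=
  fun i => if (i : ℕ) = r₁ - 1 then 1 else if (i : ℕ) = r₂ then -1 else 0

/-- The matrix `y(p,e,b,g)` (matrix representative of a point of the open Zastava
`Gr⁰_{-α}`), a `(k+1)×(k+1)` matrix over `ℂ[t] ⊆ K`. -/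
def ymat (k : ℕ) (p e : ℂ) (b g : Fin (k-1) → ℂ) :
    Matrix (Fin (k+1)) (Fin (k+1)) K :=
  fun i j =>
    if _hi0 : (i : ℕ) = 0 then
      (if _hjk : (j : ℕ) = k then Cc e else 0)
    else if _hik : (i : ℕ) = k then
      (if _hj0 : (j : ℕ) = 0 then Cc (-e⁻¹)
       else if _hjk : (j : ℕ) = k then tK - Cc (p + ∑ l : Fin (k-1), b l * g l)
       else Cc (-(g ⟨k - (j : ℕ) - 1, by have := j.isLt; omega⟩)))
    else
      (if _hji : (j : ℕ) = (i : ℕ) then 1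
       else if _hjk : (j : ℕ) = k then Cc (b ⟨k - (i : ℕ) - 1, by have := i.isLt; omega⟩)
       else 0)

/-- The matrix `x₋(v)` over `K` : identity except for the bottom row `(v_k,…,v₁,1)`. -/
def xminusK (k : ℕ) (v : Fin k → ℂ) : Matrix (Fin (k+1)) (Fin (k+1)) K :=
  fun i j =>
    if _hik : (i : ℕ) = k then
      (if _hjk : (j : ℕ) = k then 1 else Cc (v ⟨k - (j : ℕ) - 1, by have := j.isLt; omega⟩))
    else if i = j then 1 else 0

/-- `Φ_α(y)` read off from the `N₁[[t⁻¹]]`-factor `u` of a Gauss factorization of `y`. -/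
def PhiOf (n r₂ k : ℕ) (hrn : r₂ < n) (u : Matrix (Fin n) (Fin n) K) : Fin k → ℂ :=
  fun a => (u ⟨r₂ - 1 - (a : ℕ), by omega⟩ ⟨r₂, hrn⟩).coeff 1

/-- `ζ_α(y)` read off from the `N₁[[t⁻¹]]`-factor `u` of a Gauss factorization of `y`. -/
def ZetaOf (n r₁ r₂ k : ℕ) (hr1 : 1 ≤ r₁) (hrr : r₁ ≤ r₂) (hrn : r₂ < n)
    (hk : k = r₂ - r₁ + 1) (u : Matrix (Fin n) (Fin n) K) : Fin k → ℂ :=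
  fun a =>
    if _ha : (a : ℕ) = k - 1 then (u ⟨r₁ - 1, by omega⟩ ⟨r₂, hrn⟩).coeff 2
    else (u ⟨r₁ - 1, by omega⟩ ⟨r₁ + (a : ℕ), by have := a.isLt; omega⟩).coeff 1

/-- `ξ_α(y)`, computed from the `N₁[[t⁻¹]]`-factor `u` of a Gauss factorization of `y`. -/
def xiOf (n r₁ r₂ k : ℕ) (hr1 : 1 ≤ r₁) (hrr : r₁ ≤ r₂) (hrn : r₂ < n)
    (hk : k = r₂ - r₁ + 1) (u : Matrix (Fin n) (Fin n) K) : Matrix (Fin n) (Fin n) K :=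
  let c := PhiOf n r₂ k hrn u
  let z := ZetaOf n r₁ r₂ k hr1 hrr hrn hk u
  let e : ℂ := c ⟨k - 1, by omega⟩
  let b : Fin (k-1) → ℂ := fun i => c ⟨(i : ℕ), by have := i.isLt; omega⟩
  let g : Fin (k-1) → ℂ := fun i => z ⟨k - (i : ℕ) - 2, by omega⟩ / e
  let p : ℂ := z ⟨k - 1, by omega⟩ / e - ∑ i : Fin (k-1), b i * g i
  blockEmbed n r₁ k (ymat k p e b g)

/-- `M` has identity submatrix in (1-indexed) rows and columns `r₁,…,r₁+k`. -/
def HasIdBlock {R : Type*} [Zero R] [One R] {n : ℕ} (r₁ k : ℕ)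
    (M : Matrix (Fin n) (Fin n) R) : Prop :=
  ∀ i j : Fin n, r₁ - 1 ≤ (i : ℕ) → (i : ℕ) ≤ r₁ - 1 + k →
    r₁ - 1 ≤ (j : ℕ) → (j : ℕ) ≤ r₁ - 1 + k →
    M i j = if i = j then 1 else 0

/-- `M ∈ N^α(K)` : upper unitriangular over `K` with identity `(k+1)×(k+1)`-block. -/
def MemNalphaK (n r₁ k : ℕ) (M : Matrix (Fin n) (Fin n) K) : Prop :=
  IsUpperUni M ∧ HasIdBlock r₁ k M

/-- `M ∈ N^α[t]`. -/
def MemNalphaPoly (n r₁ k : ℕ) (M : Matrix (Fin n) (Fin n) K) : Prop :=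
  MemNalphaK n r₁ k M ∧ ∀ i j : Fin n, memPoly (M i j)

/-- `M ∈ N(K)^α₁ = x_α(N_{1,k+1}[[t⁻¹]])·N^α(K)`. -/
def MemNKalpha1 (n r₁ k : ℕ) (M : Matrix (Fin n) (Fin n) K) : Prop :=
  ∃ (a : Matrix (Fin (k+1)) (Fin (k+1)) K) (u : Matrix (Fin n) (Fin n) K),
    MemN1 a ∧ MemNalphaK n r₁ k u ∧ M = blockEmbed n r₁ k a * u

/-- `z = π(x)` for the slice `Gr_ν` : `z ∈ Gr_ν` and `z = a·x·b` with `a ∈ N[t]`,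
`b ∈ N₋[t]`. -/
def IsPiOf {n : ℕ} (ν : Fin n → ℤ) (x z : Matrix (Fin n) (Fin n) K) : Prop :=
  z ∈ GrSlice ν ∧ ∃ a b, MemNpoly a ∧ MemNnegPoly b ∧ z = a * x * b

/-- The open Zastava slice `Gr⁰_{-α} ⊆ GL_n(K)` : matrices `τ_α(y(p,e,b,g))`. -/
def GrZeroNegAlpha (n r₁ k : ℕ) : Set (Matrix (Fin n) (Fin n) K) :=
  { M | ∃ (p e : ℂ) (b g : Fin (k-1) → ℂ), e ≠ 0 ∧ M = blockEmbed n r₁ k (ymat k p e b g) }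

/-- `μ + α`. -/
def addAlpha (n r₁ r₂ : ℕ) (μ : Fin n → ℤ) : Fin n → ℤ :=
  fun i => μ i + alphaCo n r₁ r₂ i


theorem det_bordered_one {R : Type*} [CommRing R] {n : ℕ}
    (M : Matrix (Fin (n + 1)) (Fin (n + 1)) R)
    (h : ∀ i j : Fin n, M i.castSucc j.castSucc = if i = j then 1 else 0) :
    M.det = M (Fin.last n) (Fin.last n)
      - ∑ i : Fin n, M (Fin.last n) i.castSucc * M i.castSucc (Fin.last n) := by
  have hM : M.submatrix (finSumFinEquiv (m := n) (n := 1)) finSumFinEquiv =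
      Matrix.fromBlocks 1 (Matrix.of fun i _ => M i.castSucc (Fin.last n))
        (Matrix.of fun _ j => M (Fin.last n) j.castSucc)
        (Matrix.of fun _ _ => M (Fin.last n) (Fin.last n)) := by
    have hlast (i : Fin 1) : Fin.natAdd n i = Fin.last n := by
      ext; simp
    ext (i | i) (j | j)
    · simp only [Matrix.submatrix_apply, finSumFinEquiv_apply_left, Matrix.fromBlocks_apply₁₁,
        Matrix.one_apply]
      exact h i j
    · simp only [Matrix.submatrix_apply, finSumFinEquiv_apply_left, finSumFinEquiv_apply_right,
        hlast]
      rfl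
    · simp only [Matrix.submatrix_apply, finSumFinEquiv_apply_left, finSumFinEquiv_apply_right,
        hlast]
      rfl
    · simp only [Matrix.submatrix_apply, finSumFinEquiv_apply_right, hlast]
      rfl
  rw [← Matrix.det_submatrix_equiv_self (finSumFinEquiv (m := n) (n := 1)) M, hM,
    Matrix.det_fromBlocks_one₁₁, Matrix.det_fin_one]
  simp [Matrix.mul_apply]

theorem det_antidiagonal_corners_one {R : Type*} [CommRing R] {n : ℕ}
    (M : Matrix (Fin (n + 2)) (Fin (n + 2)) R)
    (hrow : ∀ j : Fin (n + 1), M 0 j.castSucc = 0)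
    (hcol : ∀ i : Fin (n + 1), M i.castSucc 0 = 0)
    (h : ∀ i j : Fin n, M i.castSucc.succ j.castSucc.succ = if i = j then 1 else 0) :
    M.det = -(M 0 (Fin.last (n + 1)) * M (Fin.last (n + 1)) 0) := by
  have hminor : (M.submatrix Fin.succ Fin.castSucc).det =
      (-1) ^ n * M (Fin.last (n + 1)) 0 := by
    have hone : (M.submatrix Fin.succ Fin.castSucc).submatrix Fin.castSucc Fin.succ =
        (1 : Matrix (Fin n) (Fin n) R) := by
      ext i j
      simpa [Matrix.one_apply] using h i j
    rw [Matrix.det_succ_column_zero, Fin.sum_univ_castSucc, Finset.sum_eq_zero]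
    · simp only [Fin.succAbove_last, hone]
      simp
    · intro i _
      have := hcol i.succ
      simp only [Fin.castSucc_succ] at this
      simp [this]
  rw [Matrix.det_succ_row_zero, Fin.sum_univ_castSucc, Finset.sum_eq_zero]
  · simp only [Fin.succAbove_last, hminor, Fin.val_last, zero_add]
    have : ((-1 : R) ^ n) * (-1) ^ n = 1 := by
      rw [← mul_pow]; simp
    linear_combination (-(M 0 (Fin.last (n + 1)) * M (Fin.last (n + 1)) 0)) * this
  · intro j _
    simp [hrow j]

theorem sum_rev_add_sum_ite_le {R : Type*} [AddCommMonoid R] {N n : ℕ} (hn : n ≤ N)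
    (f : Fin N → R) :
    (∑ a : Fin n, f ⟨n - (a : ℕ) - 1, by omega⟩)
      + ∑ i : Fin N, (if n ≤ (i : ℕ) then f i else 0) = ∑ i, f i := by
  obtain ⟨d, rfl⟩ := Nat.exists_eq_add_of_le hn
  rw [Fin.sum_univ_add, Fin.sum_univ_add f, ← Equiv.sum_comp Fin.revPerm]
  have h1 : ∀ i : Fin n, ¬ n ≤ ((Fin.castAdd d i : Fin (n + d)) : ℕ) := fun i => by simp
  simp only [h1, if_false, Finset.sum_const_zero, zero_add, Fin.val_natAdd, Nat.le_add_right,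
    if_true]
  congr 1
  refine Finset.sum_congr rfl fun i _ => congrArg f (Fin.ext ?_)
  simp [Fin.val_rev]
  omega

theorem sub_map_sum_mul_eq {S R : Type*} [CommRing S] [CommRing R] (φ : S →+* R) (t : R) (p : S)
    {N n : ℕ} (hn : n ≤ N) (b g : Fin N → S) :
    t - φ (p + ∑ i, b i * g i)
        - ∑ a : Fin n, φ (-g ⟨n - (a : ℕ) - 1, by omega⟩) * φ (b ⟨n - (a : ℕ) - 1, by omega⟩) =
      t - φ p - φ (∑ i : Fin N, if n ≤ (i : ℕ) then b i * g i else 0) := by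
  rw [← sum_rev_add_sum_ite_le hn fun i => b i * g i]
  simp only [map_add, map_sum, map_mul, map_neg, neg_mul, Finset.sum_neg_distrib,
    mul_comm (φ (g _))]
  ring

theorem neg_map_mul_map_neg_inv {F R : Type*} [Field F] [CommRing R] (φ : F →+* R) {e : F}
    (he : e ≠ 0) : -(φ e * φ (-e⁻¹)) = 1 := by
  rw [← map_mul, ← map_neg]
  simp [he]

/-- The lower-right `m×m` minor of `y(p,e,b,g)` is
`t − p − ∑_{i=m}^{k−1} b_i g_i`, and `det y(p,e,b,g) = 1`. -/
theorem statement1 (k : ℕ) (hk : 1 ≤ k) (p e : ℂ) (he : e ≠ 0)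
    (b g : Fin (k-1) → ℂ) :
    (∀ (m : ℕ) (hm1 : 1 ≤ m) (hm2 : m ≤ k),
      Matrix.det (Matrix.submatrix (ymat k p e b g)
          (fun a : Fin m => (⟨k + 1 - m + (a : ℕ), by have := a.isLt; omega⟩ : Fin (k+1)))
          (fun a : Fin m => (⟨k + 1 - m + (a : ℕ), by have := a.isLt; omega⟩ : Fin (k+1))))
        = tK - Cc p - Cc (∑ i : Fin (k-1), if m ≤ (i : ℕ) + 1 then b i * g i else 0)) ∧
    Matrix.det (ymat k p e b g) = 1 := by
  refine ⟨fun m _ hm2 => ?_, ?_⟩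
  · obtain ⟨n, rfl⟩ : ∃ n, m = n + 1 := ⟨m - 1, by omega⟩
    rw [det_bordered_one]
    · have hcorner : k + 1 - (n + 1) + n = k := by omega
      have hk0 : k ≠ 0 := by omega
      simp only [Matrix.submatrix_apply, Fin.val_last, Fin.val_castSucc, ymat, hcorner, hk0,
        dif_neg, dif_pos, not_false_eq_true, Nat.add_le_add_iff_right]
      have hterm : ∀ a : Fin n, k + 1 - (n + 1) + (a : ℕ) ≠ 0 ∧
          k + 1 - (n + 1) + (a : ℕ) ≠ k ∧ k ≠ k + 1 - (n + 1) + (a : ℕ) ∧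
          k - (k + 1 - (n + 1) + (a : ℕ)) - 1 = n - (a : ℕ) - 1 := fun a => by omega
      simp only [hterm, dif_neg, not_false_eq_true]
      exact sub_map_sum_mul_eq HahnSeries.C tK p (show n ≤ k - 1 by omega) b g
    · intro i j
      have h0 : k + 1 - (n + 1) + (i : ℕ) ≠ 0 := by omega
      have h1 : k + 1 - (n + 1) + (i : ℕ) ≠ k := by omega
      have h2 : k + 1 - (n + 1) + (j : ℕ) ≠ k := by omega
      simp only [Matrix.submatrix_apply, Fin.val_castSucc, ymat, h0, h1, h2, dif_neg,
        not_false_eq_true, Nat.add_right_inj, Fin.ext_iff, dite_eq_ite, eq_comm]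
  · obtain ⟨n, rfl⟩ : ∃ n, k = n + 1 := ⟨k - 1, by omega⟩
    rw [det_antidiagonal_corners_one]
    · simp only [ymat, Fin.val_last, Fin.val_zero, dif_pos, Nat.add_eq_zero_iff, one_ne_zero,
        and_false, dif_neg, not_false_eq_true]
      exact neg_map_mul_map_neg_inv (F := ℂ) (R := K) HahnSeries.C he
    · intro j
      have := j.isLt.ne
      simp [ymat, this]
    · intro i
      have h0 := i.isLt.ne
      by_cases h : (i : ℕ) = 0
      · simp [ymat, h]
      · simp [ymat, h0, h, Ne.symm h]
    · intro i j
      have h0 := i.isLt.ne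
      have h1 := j.isLt.ne
      simp [ymat, h0, h1, Fin.ext_iff, eq_comm]

end
end

section
/- Fix k ≥ 1, p ∈ ℂ, e ∈ ℂ×, and b = (b₁,…,b_{k−1}), g = (g₁,…,g_{k−1}) ∈ ℂ^{k−1}. Then y(p,e,b,g) is invertible over the field ℂ(t) of rational functions, and its inverse is the (k+1)×(k+1) matrix whose first row is (t−p, −e g_{k−1}, −e g_{k−2}, …, −e g₁, −e); whose i-th row, for 2 ≤ i ≤ k, has entry −b_{k+1−i}/e in position (i,1), entry 1 in position (i,i), and zeros elsewhere; and whose last row is (1/e, 0, …, 0). -/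
open Matrix

noncomputable section

/-- The explicit inverse matrix of `y(p,e,b,g)`. -/
def yinvmat (k : ℕ) (p e : ℂ) (b g : Fin (k-1) → ℂ) :
    Matrix (Fin (k+1)) (Fin (k+1)) K :=
  fun i j =>
    if _hi0 : (i : ℕ) = 0 then
      (if _hj0 : (j : ℕ) = 0 then tK - Cc p
       else if _hjk : (j : ℕ) = k then Cc (-e)
       else Cc (-(e * g ⟨k - (j : ℕ) - 1, by have := j.isLt; omega⟩)))
    else if _hik : (i : ℕ) = k then
      (if _hj0 : (j : ℕ) = 0 then Cc e⁻¹ else 0)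
    else
      (if _hj0 : (j : ℕ) = 0 then Cc (-(b ⟨k - (i : ℕ) - 1, by have := i.isLt; omega⟩ / e))
       else if _hji : (j : ℕ) = (i : ℕ) then 1 else 0)

theorem fin_cases_ends {m : ℕ} {P : Fin (m + 2) → Prop} (zero : P 0)
    (mid : ∀ i : Fin m, P i.castSucc.succ) (last : P (Fin.last m).succ) (i : Fin (m + 2)) : P i :=
  Fin.cases zero (Fin.lastCases last mid) i

/-- The vector `(x, v₀, …, v_{m-1}, y)`. -/
def endsVec {F : Type*} {m : ℕ} (x : F) (v : Fin m → F) (y : F) : Fin (m + 2) → F :=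
  Fin.cons x (Fin.snoc v y : Fin (m + 1) → F)

@[simp] theorem endsVec_zero {F : Type*} {m : ℕ} (x : F) (v : Fin m → F) (y : F) :
    endsVec x v y 0 = x := rfl

@[simp] theorem endsVec_mid {F : Type*} {m : ℕ} (x : F) (v : Fin m → F) (y : F) (i : Fin m) :
    endsVec x v y i.castSucc.succ = v i := by
  simp [endsVec]

@[simp] theorem endsVec_last {F : Type*} {m : ℕ} (x : F) (v : Fin m → F) (y : F) :
    endsVec x v y (Fin.last m).succ = y := by
  simp [endsVec, -Fin.succ_last]

section

variable {R F : Type*} [Field R] [Field F] {m : ℕ} (C : R →+* F) (t : F) (p e : R)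
  (b g : Fin m → R)

/-- The matrix `y(p,e,b,g)` for a variable `t` in an arbitrary field `F` over `R`. -/
def slice : Matrix (Fin (m + 2)) (Fin (m + 2)) F :=
  endsVec (endsVec 0 0 (C e))
    (fun i => endsVec 0 (Pi.single i 1) (C (b i.rev)))
    (endsVec (C (-e⁻¹)) (fun j => C (-g j.rev)) (t - C (p + ∑ l, b l * g l)))

/-- The inverse of `slice C t p e b g`. -/
def sliceInv : Matrix (Fin (m + 2)) (Fin (m + 2)) F :=
  endsVec (endsVec (t - C p) (fun j => C (-(e * g j.rev))) (C (-e)))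
    (fun i => endsVec (C (-(b i.rev / e))) (Pi.single i 1) 0)
    (endsVec (C e⁻¹) 0 0)

theorem slice_mul_sliceInv (he : e ≠ 0) : slice C t p e b g * sliceInv C t p e b g = 1 := by
  have hC : C e ≠ 0 := by simpa using he
  have hrev : ∑ j : Fin m, C (g j.rev) * C (b j.rev) = ∑ j, C (b j) * C (g j) := by
    rw [← Equiv.sum_comp Fin.revPerm]
    simp [mul_comm]
  ext1 i j
  rw [mul_apply, Fin.sum_univ_succ, Fin.sum_univ_castSucc]
  induction i using fin_cases_ends <;> induction j using fin_cases_ends <;>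
    simp [slice, sliceInv, one_apply, Pi.single_apply, hC, div_eq_mul_inv, ← mul_assoc,
      ← Finset.sum_mul, hrev, -Fin.succ_last, (Fin.succ_ne_zero _).symm,
      Fin.castSucc_ne_last, eq_comm]
  ring

end

theorem ymat_eq_slice {m : ℕ} (p e : ℂ) (b g : Fin m → ℂ) :
    ymat (m + 1) p e b g = slice (HahnSeries.C : ℂ →+* K) tK p e b g := by
  have ne (i : Fin m) : (i : ℕ) ≠ m := i.isLt.ne
  ext1 i j
  induction i using fin_cases_ends <;> induction j using fin_cases_ends <;>
    simp [ymat, slice, Cc, -Fin.succ_last, ne, (ne _).symm, Fin.rev, Nat.sub_sub,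
      Pi.single_apply, Fin.ext_iff]

theorem yinvmat_eq_sliceInv {m : ℕ} (p e : ℂ) (b g : Fin m → ℂ) :
    yinvmat (m + 1) p e b g = sliceInv (HahnSeries.C : ℂ →+* K) tK p e b g := by
  have ne (i : Fin m) : (i : ℕ) ≠ m := i.isLt.ne
  ext1 i j
  induction i using fin_cases_ends <;> induction j using fin_cases_ends <;>
    simp [yinvmat, sliceInv, Cc, -Fin.succ_last, ne, (ne _).symm, Fin.rev, Nat.sub_sub,
      Pi.single_apply, Fin.ext_iff]

/-- `y(p,e,b,g)` is invertible, with the explicitly given inverse. -/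
theorem statement2 (k : ℕ) (hk : 1 ≤ k) (p e : ℂ) (he : e ≠ 0)
    (b g : Fin (k-1) → ℂ) :
    ymat k p e b g * yinvmat k p e b g = 1 ∧
    yinvmat k p e b g * ymat k p e b g = 1 := by
  obtain ⟨m, rfl⟩ := Nat.exists_eq_add_of_le' hk
  have h : ymat (m + 1) p e b g * yinvmat (m + 1) p e b g = 1 := by
    rw [ymat_eq_slice, yinvmat_eq_sliceInv]
    exact slice_mul_sliceInv _ _ _ _ _ _ he
  exact ⟨h, mul_eq_one_comm.mp h⟩

end
end

section
/- Fix k ≥ 1, p ∈ ℂ, e ∈ ℂ×, and b = (b₁,…,b_{k−1}), g = (g₁,…,g_{k−1}) ∈ ℂ^{k−1}. Set Δ_m := t − p − ∑_{i=m}^{k−1} b_i g_i ∈ ℂ[t] for 1 ≤ m ≤ k and Δ₀ := 1, Δ_{k+1} := 1. Then over the field ℂ(t) there exist an upper unitriangular matrix U and a lower unitriangular matrix L of size (k+1)×(k+1) such that y(p,e,b,g) = U·D·L, where D is the diagonal matrix with entries D_{jj} = Δ_{k+2−j}/Δ_{k+1−j} for 1 ≤ j ≤ k+1 (so D₁₁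 = 1/(t−p) and D_{k+1,k+1} = t − p − ∑_{i=1}^{k−1} b_i g_i). -/
open Matrix

noncomputable section

/-- `Δ_m = t − p − ∑_{i=m}^{k−1} b_i g_i` for `1 ≤ m ≤ k`, and `Δ_m = 1` otherwise. -/
def Delta (k : ℕ) (p : ℂ) (b g : Fin (k-1) → ℂ) (m : ℕ) : K :=
  if 1 ≤ m ∧ m ≤ k then
    tK - Cc p - Cc (∑ i : Fin (k-1), if m ≤ (i : ℕ) + 1 then b i * g i else 0)
  else 1

/-- The upper unitriangular matrix with entries `c i * G j / ε j` above the diagonal. -/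
def udlUpper {F : Type*} [Field F] (k : ℕ) (c G ε : ℕ → F) :
    Matrix (Fin (k + 1)) (Fin (k + 1)) F :=
  fun i j => if (i : ℕ) = j then 1 else if (i : ℕ) < j then c i * G j / ε j else 0

/-- The lower unitriangular matrix with entries `c i * G j / ε i` below the diagonal. -/
def udlLower {F : Type*} [Field F] (k : ℕ) (c G ε : ℕ → F) :
    Matrix (Fin (k + 1)) (Fin (k + 1)) F :=
  fun i j => if (i : ℕ) = j then 1 else if (j : ℕ) < i then c i * G j / ε i else 0

theorem isUpperUni_udlUpper {F : Type*} [Field F] (k : ℕ) (c G ε : ℕ → F) :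
    IsUpperUni (udlUpper k c G ε) := by
  refine ⟨fun i => by simp [udlUpper], fun i j hij => ?_⟩
  have : (j : ℕ) < i := hij
  simp [udlUpper, this.ne', this.not_gt]

theorem isLowerUni_udlLower {F : Type*} [Field F] (k : ℕ) (c G ε : ℕ → F) :
    IsLowerUni (udlLower k c G ε) := by
  refine ⟨fun i => by simp [udlLower], fun i j hij => ?_⟩
  have : (i : ℕ) < j := hij
  simp [udlLower, this.ne, this.not_gt]

/-- The product of the three factors, written as a sum over a range. -/
theorem udl_mul_apply {F : Type*} [Field F] (k : ℕ) (c G ε : ℕ → F) (i j : Fin (k + 1)) :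
    (udlUpper k c G ε * Matrix.diagonal (fun j : Fin (k + 1) => ε j / ε (j + 1)) *
      udlLower k c G ε) i j =
    ∑ m ∈ Finset.range (k + 1),
      (if (i : ℕ) = m then 1 else if (i : ℕ) < m then c i * G m / ε m else 0) *
        (ε m / ε (m + 1)) *
        (if m = (j : ℕ) then 1 else if (j : ℕ) < m then c m * G j / ε m else 0) := by
  rw [Matrix.mul_apply, ← Fin.sum_univ_eq_sum_range (fun m =>
      (if (i : ℕ) = m then 1 else if (i : ℕ) < m then c i * G m / ε m else 0) *
        (ε m / ε (m + 1)) *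
        (if m = (j : ℕ) then 1 else if (j : ℕ) < m then c m * G j / ε m else 0))]
  simp only [Matrix.mul_diagonal, udlUpper, udlLower]

/-- Partial sums of the product of the three factors telescope. -/
theorem udl_partial_sum {F : Type*} [Field F] (k : ℕ) (c G ε : ℕ → F)
    (hε : ∀ n, ε n ≠ 0) (h_zero : ε 0 = 1) (hcG : c 0 * G 0 = 1)
    (hrec : ∀ n, 0 < n → n < k → ε (n + 1) = ε n - c n * G n) (i j n : ℕ) (hn : n ≤ k) :
    ∑ m ∈ Finset.range n,
      (if i = m then 1 else if i < m then c i * G m / ε m else 0) * (ε m / ε (m + 1)) *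
        (if m = j then 1 else if j < m then c m * G j / ε m else 0) =
    if i < n ∧ j < n then (if i = j ∧ i ≠ 0 then 1 else 0) + c i * G j / ε n else 0 := by
  induction n with
  | zero => simp
  | succ n ih =>
    rw [Finset.sum_range_succ, ih (by omega)]
    have h1 := hε n
    have h2 := hε (n + 1)
    have hr := hrec n
    rcases lt_trichotomy i n with hi | rfl | hi
    · rcases lt_trichotomy j n with hj | rfl | hj
      · have hr' := hr (by omega) (by omega)
        have e1 : i < n + 1 := by omega
        have e2 : j < n + 1 := by omega
        simp only [hi, hj, hi.ne, hj.ne', e1, e2, and_self, if_true, if_false]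
        field_simp
        rw [hr']
        ring
      · have e1 : i < j + 1 := by omega
        simp [hi, hi.ne, e1]
        field_simp
      · have e2 : ¬ j < n + 1 := by omega
        simp [hj.ne, hj.not_gt, e2]
    · rcases lt_trichotomy j i with hj | rfl | hj
      · have e1 : j < i + 1 := by omega
        simp [hj, hj.ne', e1]
        field_simp
      · rcases Nat.eq_zero_or_pos j with rfl | hpos
        · simp [h_zero, hcG]
        · have hr' := hr hpos (by omega)
          simp [hpos.ne']
          field_simp
          rw [hr']
          ring
      · have e2 : ¬ j < i + 1 := by omega
        simp [hj.ne, hj.not_gt, e2]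
    · have e2 : ¬ i < n + 1 := by omega
      simp [hi.ne', hi.not_gt, e2]

theorem Cc_mul (x y : ℂ) : Cc (x * y) = Cc x * Cc y := map_mul HahnSeries.C x y

theorem Cc_add (x y : ℂ) : Cc (x + y) = Cc x + Cc y := map_add HahnSeries.C x y

theorem Cc_neg (x : ℂ) : Cc (-x) = -Cc x := map_neg HahnSeries.C x

theorem Cc_one : Cc 1 = 1 := map_one HahnSeries.C

theorem tK_sub_Cc_ne_zero (x : ℂ) : tK - Cc x ≠ 0 := by
  intro h
  have h' := congrArg (fun f : K => f.coeff (-1)) h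
  simp [tK, Cc, HahnSeries.C_apply] at h'

theorem Delta_ne_zero (k : ℕ) (p : ℂ) (b g : Fin (k - 1) → ℂ) (m : ℕ) :
    Delta k p b g m ≠ 0 := by
  unfold Delta
  split_ifs
  · rw [sub_sub, ← Cc_add]
    exact tK_sub_Cc_ne_zero _
  · exact one_ne_zero

theorem Delta_rec (k : ℕ) (p : ℂ) (b g : Fin (k - 1) → ℂ) (m : ℕ) (hm : 0 < m) (hmk : m < k) :
    Delta k p b g m = Delta k p b g (m + 1) -
      Cc (b ⟨m - 1, by omega⟩) * Cc (g ⟨m - 1, by omega⟩) := by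
  have hsum : (∑ i : Fin (k - 1), if m ≤ (i : ℕ) + 1 then b i * g i else 0) =
      (∑ i : Fin (k - 1), if m + 1 ≤ (i : ℕ) + 1 then b i * g i else 0) +
        b ⟨m - 1, by omega⟩ * g ⟨m - 1, by omega⟩ := by
    have hpick := Finset.sum_ite_eq' Finset.univ (⟨m - 1, by omega⟩ : Fin (k - 1))
      (fun i => b i * g i)
    rw [if_pos (Finset.mem_univ _)] at hpick
    rw [← hpick]
    rw [← Finset.sum_add_distrib]
    refine Finset.sum_congr rfl fun i _ => ?_
    simp only [Fin.ext_iff]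
    split_ifs <;> first | omega | simp
  have h1 : 1 ≤ m ∧ m ≤ k := by omega
  have h2 : 1 ≤ m + 1 ∧ m + 1 ≤ k := by omega
  rw [Delta, Delta, if_pos h1, if_pos h2, hsum, Cc_add, Cc_mul]
  ring

/-- Gauss (UDL) decomposition of `y(p,e,b,g)` with explicit diagonal
factor `D_{jj} = Δ_{k+2−j}/Δ_{k+1−j}` (1-indexed `j`). -/
theorem statement3 (k : ℕ) (hk : 1 ≤ k) (p e : ℂ) (he : e ≠ 0)
    (b g : Fin (k-1) → ℂ) :
    ∃ U L : Matrix (Fin (k+1)) (Fin (k+1)) K,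
      IsUpperUni U ∧ IsLowerUni L ∧
      ymat k p e b g =
        U * Matrix.diagonal (fun j : Fin (k+1) =>
              Delta k p b g (k + 1 - (j : ℕ)) / Delta k p b g (k - (j : ℕ))) * L := by
  have hk0 : k ≠ 0 := by omega
  let c : ℕ → K := fun n => if n = 0 then Cc e else
    if h : 0 < n ∧ n < k then Cc (b ⟨k - n - 1, by omega⟩) else -1
  let G : ℕ → K := fun n => if n = 0 then Cc e⁻¹ else
    if h : 0 < n ∧ n < k then Cc (g ⟨k - n - 1, by omega⟩) else 1
  let ε : ℕ → K := fun n => Delta k p b g (k + 1 - n)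
  have hε : ∀ n, ε n ≠ 0 := fun n => Delta_ne_zero _ _ _ _ _
  have h_zero : ε 0 = 1 := by simp [ε, Delta]
  have h_last : ε (k + 1) = 1 := by simp [ε, Delta]
  have hcG : c 0 * G 0 = 1 := by simp [c, G, ← Cc_mul, he, Cc_one]
  have hck : c k = -1 := by simp [c, hk0]
  have hGk : G k = 1 := by simp [G, hk0]
  have hrec : ∀ n, 0 < n → n < k → ε (n + 1) = ε n - c n * G n := by
    intro n hn hnk
    have h := Delta_rec k p b g (k - n) (by omega) (by omega)
    simp only [ε, c, G, hn.ne', hn, hnk, and_self, if_false, dif_pos]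
    rw [show k + 1 - (n + 1) = k - n by omega, show k + 1 - n = k - n + 1 by omega]
    exact h
  have hεk : ε k = tK - Cc (p + ∑ l : Fin (k - 1), b l * g l) := by
    simp [ε, Delta, hk, Cc_add, sub_sub]
  refine ⟨udlUpper k c G ε, udlLower k c G ε, isUpperUni_udlUpper k c G ε,
    isLowerUni_udlLower k c G ε, ?_⟩
  have hD : (fun j : Fin (k + 1) =>
      Delta k p b g (k + 1 - (j : ℕ)) / Delta k p b g (k - (j : ℕ))) =
      fun j : Fin (k + 1) => ε j / ε (j + 1) := by
    funext j
    simp only [ε, Nat.add_sub_add_right]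
  rw [hD]
  ext1 i j
  have hεk0 := hε k
  rw [udl_mul_apply, Finset.sum_range_succ,
    udl_partial_sum k c G ε hε h_zero hcG hrec i j k le_rfl, hck, hGk, h_last]
  have hi' := i.isLt
  have hj' := j.isLt
  rcases eq_or_lt_of_le (Nat.le_of_lt_succ hi') with hi | hi
  · rcases eq_or_lt_of_le (Nat.le_of_lt_succ hj') with hj | hj
    · simp [ymat, hi, hj, hk0, hεk]
    · have e1 : ymat k p e b g i j = -G j := by
        by_cases hj0 : (j : ℕ) = 0
        · simp [ymat, hi, hj0, hk0, G, Cc_neg]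
        · simp [ymat, hi, hj0, hk0, hj.ne, hj, G, Cc_neg, Nat.pos_iff_ne_zero]
      rw [e1]
      simp [hi, hj, hj.ne']
      field_simp
  · rcases eq_or_lt_of_le (Nat.le_of_lt_succ hj') with hj | hj
    · have e1 : ymat k p e b g i j = c i := by
        by_cases hi0 : (i : ℕ) = 0
        · simp [ymat, hi0, hj, c]
        · simp [ymat, hi0, hj, hi.ne, hi.ne', hi, c, Nat.pos_iff_ne_zero]
      rw [e1]
      simp [hi, hi.ne, hj]
      field_simp
    · have e1 : ymat k p e b g i j = if (i : ℕ) = j ∧ (i : ℕ) ≠ 0 then 1 else 0 := by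
        by_cases hi0 : (i : ℕ) = 0
        · simp [ymat, hi0, hj.ne]
        · simp [ymat, hi0, hi.ne, hj.ne, eq_comm]
      rw [e1]
      simp only [hi, hj, hi.ne, hj.ne', and_self, if_true, if_false]
      field_simp
      ring

end
end
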